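/- arXiv:2110.08748 — 5 statements merged into one kernel-verified Lean document; each statement's English description precedes it below -/
import Mathlib

section
/- Let k be a field, B a commutative k-algebra, and J an ideal of B. Assume B = k[{a_{i,j} : i=1,…,r, j=1,…,N} ∪ U] where r ≥ 2, N ≥ 1, the a_{i,j} are elements of B satisfying a_{i₁,j}·a_{i₂,j} ∈ J for all 1 ≤ i₁ < i₂ ≤ r and j = 1,…,N, and U is a finite subset of J. Define A := k[{a_{1,j}+⋯+a_{r,j} : j=1,…,N}] + J. Then B is integral over A. -/
open scoped Pointwise

/-- The sum `S + J` of a subalgebra `S` and an ideal `J` is a subalgebra. -/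
theorem exists_subalgebra_coe_eq_add_ideal {k B : Type*} [CommRing k] [CommRing B] [Algebra k B]
    (S : Subalgebra k B) (J : Ideal B) :
    ∃ T : Subalgebra k B, (T : Set B) = (S : Set B) + (J : Set B) := by
  refine ⟨(S.map (Ideal.Quotient.mkₐ k J)).comap (Ideal.Quotient.mkₐ k J), ?_⟩
  ext x
  simp only [Subalgebra.coe_comap, Set.mem_preimage, SetLike.mem_coe, Subalgebra.mem_map,
    Ideal.Quotient.mkₐ_eq_mk, Set.mem_add]
  constructor
  · rintro ⟨s, hs, h⟩
    exact ⟨s, hs, x - s, Ideal.Quotient.eq.mp h.symm, by ring⟩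
  · rintro ⟨s, hs, y, hy, rfl⟩
    exact ⟨s, hs, (Ideal.Quotient.eq.mpr (by simpa using hy)).symm⟩

/-- An element satisfying `x * (s - x) = c` with `s` and `c` in a subalgebra is integral over it. -/
theorem isIntegral_of_mul_sub_mem {k B : Type*} [CommRing k] [CommRing B] [Algebra k B]
    (T : Subalgebra k B) {x s : B} (hs : s ∈ T) (hc : x * (s - x) ∈ T) : IsIntegral T x := by
  nontriviality B
  refine ⟨Polynomial.X ^ 2 -
    (Polynomial.C (⟨s, hs⟩ : T) * Polynomial.X - Polynomial.C ⟨x * (s - x), hc⟩), ?_, ?_⟩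
  · monicity!
  · simp only [Polynomial.eval₂_sub, Polynomial.eval₂_mul, Polynomial.eval₂_pow,
      Polynomial.eval₂_X, Polynomial.eval₂_C, Subalgebra.algebraMap_def,
      Algebra.algebraMap_self_apply]
    ring

/-- Lemma 2.1(i): with `B = k[{a_{i,j}} ∪ U]`, `a_{i₁,j} a_{i₂,j} ∈ J` for `i₁ < i₂`,
`U ⊆ J` finite, and `A = k[{a_{1,j}+⋯+a_{r,j} : j}] + J`, the ring `B` is integral over `A`:
every element of `B` is a root of a monic polynomial all of whose coefficients lie in `A`. -/
theorem stmt_0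
    (k : Type) [Field k] (B : Type) [CommRing B] [Algebra k B]
    (J : Ideal B)
    {r N : ℕ} (hr : 2 ≤ r) (hN : 1 ≤ N)
    (a : Fin r → Fin N → B)
    (hprod : ∀ i₁ i₂ : Fin r, i₁ < i₂ → ∀ j : Fin N, a i₁ j * a i₂ j ∈ J)
    (U : Finset B) (hU : (U : Set B) ⊆ (J : Set B))
    (hB : Algebra.adjoin k ((Set.range fun p : Fin r × Fin N => a p.1 p.2) ∪ ↑U) = ⊤)
    (A : Set B)
    (hA : A = ↑(Algebra.adjoin k (Set.range fun j : Fin N => ∑ i : Fin r, a i j))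
      + (J : Set B)) :
    ∀ x : B, ∃ p : Polynomial B, p.Monic ∧ (∀ m : ℕ, p.coeff m ∈ A) ∧
      Polynomial.eval x p = 0 := by
  obtain ⟨T, hT⟩ := exists_subalgebra_coe_eq_add_ideal
    (Algebra.adjoin k (Set.range fun j : Fin N => ∑ i : Fin r, a i j)) J
  rw [← hT] at hA
  subst hA
  have hJ : ∀ y ∈ J, y ∈ T := fun y hy => by
    rw [← SetLike.mem_coe, hT]
    exact ⟨0, zero_mem _, y, hy, zero_add y⟩
  have hsum : ∀ j, ∑ i, a i j ∈ T := fun j => by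
    rw [← SetLike.mem_coe, hT]
    exact ⟨_, Algebra.subset_adjoin ⟨j, rfl⟩, 0, J.zero_mem, add_zero _⟩
  have hne : ∀ i i' : Fin r, i' ≠ i → ∀ j, a i j * a i' j ∈ J := fun i i' h j => by
    rcases lt_or_gt_of_ne h with h | h
    · rw [mul_comm]
      exact hprod _ _ h j
    · exact hprod _ _ h j
  have htop : (⊤ : Subalgebra k B) ≤ (integralClosure T B).restrictScalars k := by
    rw [← hB, Algebra.adjoin_le_iff]
    rintro x (⟨⟨i, j⟩, rfl⟩ | hx)
    · refine isIntegral_of_mul_sub_mem T (hsum j) (hJ _ ?_)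
      rw [← Finset.add_sum_erase _ _ (Finset.mem_univ i), add_sub_cancel_left, Finset.mul_sum]
      exact J.sum_mem fun i' hi' => hne i i' (Finset.ne_of_mem_erase hi') j
    · exact isIntegral_algebraMap (R := T) (x := ⟨x, hJ x (hU hx)⟩)
  intro x
  obtain ⟨p, hp, hx⟩ : IsIntegral T x := htop (Algebra.mem_top (x := x))
  refine ⟨p.map (algebraMap T B), hp.map _, fun m => ?_, ?_⟩
  · rw [Polynomial.coeff_map]
    exact (p.coeff m).2
  · rwa [Polynomial.eval_map]
end

section
/- Let S be an additive submonoid of ℤ^n such that the convex cone ℝ_{≥0}S generated by S equals Σ_{i=1}^s ℝ_{≥0}a_i for some s ≥ 0 and a_1,…,a_s ∈ S. Then there exists a finite subset F of S such that S = Σ_{i=1}^s ℤ_{≥0}a_i + F. In particular, S is a finitely generated monoid. -/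
open scoped NNReal

/-- The embedding `ℤ^n → ℝ^n`. -/
def toR {n : ℕ} (a : Fin n → ℤ) : Fin n → ℝ := fun i => (a i : ℝ)

/-- The integral points of a zonotope with integral generators form a finite set. -/
theorem finite_setOf_toR_eq_sum_smul {n s : ℕ} (a : Fin s → Fin n → ℤ) :
    {r : Fin n → ℤ | ∃ μ : Fin s → ℝ≥0, (∀ i, μ i ≤ 1) ∧
      toR r = ∑ i, μ i • toR (a i)}.Finite := by
  refine (Set.finite_Icc (fun j => -∑ i, |a i j|) (fun j => ∑ i, |a i j|)).subset ?_
  rintro r ⟨μ, hμ, hr⟩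
  have key (j : Fin n) : |r j| ≤ ∑ i, |a i j| := by
    have h : (r j : ℝ) = ∑ i, (μ i : ℝ) * (a i j : ℝ) := by
      simpa [toR, Finset.sum_apply, NNReal.smul_def] using congrFun hr j
    have h' : |(r j : ℝ)| ≤ ∑ i, |(a i j : ℝ)| := by
      rw [h]
      refine (Finset.abs_sum_le_sum_abs _ _).trans (Finset.sum_le_sum fun i _ => ?_)
      rw [abs_mul, abs_of_nonneg (μ i).coe_nonneg]
      exact mul_le_of_le_one_left (abs_nonneg _) (by exact_mod_cast hμ i)
    exact_mod_cast h'
  exact ⟨fun j => (abs_le.1 (key j)).1, fun j => (abs_le.1 (key j)).2⟩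

/-- Subtracting the integral parts of the coefficients moves an integral point of a cone into the
zonotope spanned by the generators. -/
theorem exists_eq_sum_nsmul_add_of_mem_span {n s : ℕ} (a : Fin s → Fin n → ℤ) {x : Fin n → ℤ}
    (hx : toR x ∈ Submodule.span ℝ≥0 (Set.range fun i => toR (a i))) :
    ∃ (m : Fin s → ℕ) (r : Fin n → ℤ), x = (∑ i, m i • a i) + r ∧
      ∃ μ : Fin s → ℝ≥0, (∀ i, μ i ≤ 1) ∧ toR r = ∑ i, μ i • toR (a i) := by
  obtain ⟨c, hc⟩ := (Submodule.mem_span_range_iff_exists_fun ℝ≥0).1 hx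
  refine ⟨fun i => ⌊c i⌋₊, x - ∑ i, ⌊c i⌋₊ • a i, by abel, fun i => c i - ⌊c i⌋₊, fun i => ?_, ?_⟩
  · rw [tsub_le_iff_left]
    exact (Nat.lt_floor_add_one (c i)).le
  · ext j
    have h : ∑ i, (c i : ℝ) * (a i j : ℝ) = x j := by
      simpa [toR, Finset.sum_apply, NNReal.smul_def] using congrFun hc j
    have hsub (i : Fin s) : ((c i - (⌊c i⌋₊ : ℝ≥0) : ℝ≥0) : ℝ) = c i - (⌊c i⌋₊ : ℝ) := by
      rw [NNReal.coe_sub (Nat.floor_le zero_le)]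
      simp
    simp [toR, Finset.sum_apply, NNReal.smul_def, hsub, sub_mul, Finset.sum_sub_distrib, h]

/-- The minimal elements of a set of vectors of natural numbers form a finite set
(Dickson's lemma). -/
theorem finite_setOf_minimal_pi_nat {s : ℕ} (P : (Fin s → ℕ) → Prop) :
    {m | Minimal P m}.Finite :=
  WellQuasiOrderedLE.finite_of_isAntichain (setOfPred_minimal_antichain P)

/-- Lemma 3.1 (a variant of Gordan's lemma): if `S` is an additive submonoid of `ℤ^n` whose
generated convex cone `ℝ_{≥0}S` equals `Σ_{i=1}^s ℝ_{≥0} a_i` for some `a_1,…,a_s ∈ S`, then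
`S = Σ_{i=1}^s ℤ_{≥0} a_i + F` for a finite subset `F ⊆ S`; in particular `S` is a finitely
generated monoid. -/
theorem stmt_10 {n : ℕ} (S : AddSubmonoid (Fin n → ℤ))
    {s : ℕ} (a : Fin s → Fin n → ℤ) (ha : ∀ i, a i ∈ S)
    (hcone : (Submodule.span ℝ≥0 (toR '' (S : Set (Fin n → ℤ))) :
        Submodule ℝ≥0 (Fin n → ℝ)) =
      Submodule.span ℝ≥0 (Set.range fun i => toR (a i))) :
    (∃ F : Finset (Fin n → ℤ), (F : Set (Fin n → ℤ)) ⊆ (S : Set (Fin n → ℤ)) ∧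
      (S : Set (Fin n → ℤ)) =
        {x | ∃ (m : Fin s → ℕ) (f : Fin n → ℤ), f ∈ F ∧ x = (∑ i, m i • a i) + f}) ∧
    ∃ T : Finset (Fin n → ℤ),
      AddSubmonoid.closure (T : Set (Fin n → ℤ)) = S := by
  have hsum (m : Fin s → ℕ) : ∑ i, m i • a i ∈ S :=
    S.sum_mem fun i _ => S.nsmul_mem (ha i) _
  have hF : ∃ F : Finset (Fin n → ℤ), (F : Set (Fin n → ℤ)) ⊆ (S : Set (Fin n → ℤ)) ∧
      (S : Set (Fin n → ℤ)) =
        {x | ∃ (m : Fin s → ℕ) (f : Fin n → ℤ), f ∈ F ∧ x = (∑ i, m i • a i) + f} := by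
    have hfin := (finite_setOf_toR_eq_sum_smul a).biUnion fun r _ =>
      (finite_setOf_minimal_pi_nat fun m => (∑ i, m i • a i) + r ∈ S).image
        fun m => (∑ i, m i • a i) + r
    have hsub : (hfin.toFinset : Set (Fin n → ℤ)) ⊆ S := by
      intro f hf
      simp only [Set.Finite.coe_toFinset, Set.mem_iUnion] at hf
      obtain ⟨r, -, m, hm, rfl⟩ := hf
      rw [Set.mem_ofPred_eq] at hm
      exact hm.prop
    refine ⟨hfin.toFinset, hsub, Set.Subset.antisymm (fun x hx => ?_) ?_⟩
    · have hxcone : toR x ∈ Submodule.span ℝ≥0 (Set.range fun i => toR (a i)) := by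
        rw [← hcone]
        exact Submodule.subset_span ⟨x, hx, rfl⟩
      obtain ⟨m, r, rfl, hr⟩ := exists_eq_sum_nsmul_add_of_mem_span a hxcone
      obtain ⟨m₀, hle, hmin⟩ := exists_minimal_le_of_wellFoundedLT
        (fun m : Fin s → ℕ => (∑ i, m i • a i) + r ∈ S) m hx
      refine ⟨m - m₀, (∑ i, m₀ i • a i) + r, ?_, ?_⟩
      · simp only [Set.Finite.mem_toFinset, Set.mem_iUnion]
        exact ⟨r, hr, m₀, hmin, rfl⟩
      · rw [← add_assoc, ← Finset.sum_add_distrib]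
        congr 1
        refine Finset.sum_congr rfl fun i _ => ?_
        rw [← add_nsmul, Pi.sub_apply, Nat.sub_add_cancel (hle i)]
    · rintro x ⟨m, f, hf, rfl⟩
      exact S.add_mem (hsum m) (hsub hf)
  refine ⟨hF, ?_⟩
  obtain ⟨F, hFS, hS⟩ := hF
  classical
  refine ⟨Finset.univ.image a ∪ F, le_antisymm (AddSubmonoid.closure_le.2 fun x hx => ?_)
    fun x hx => ?_⟩
  · simp only [Finset.coe_union, Finset.coe_image, Finset.coe_univ, Set.image_univ] at hx
    obtain ⟨i, rfl⟩ | hx := hx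
    · exact ha i
    · exact hFS hx
  · obtain ⟨m, f, hf, rfl⟩ := hS.subset hx
    refine add_mem (sum_mem fun i _ => nsmul_mem (AddSubmonoid.subset_closure ?_) _)
      (AddSubmonoid.subset_closure ?_)
    · simp
    · simp [hf]
end

section
/- Let ⪯ ∈ Ω, s ≥ 1, and a_1,…,a_s ∈ ℤ^n with a_i ≻ 0 for all i. Then there exists w ∈ 𝒲 such that w·a_1 > 0, …, w·a_s > 0. -/
/-- The standard inner product on `ℝ^n`. -/
def dotR {n : ℕ} (w a : Fin n → ℝ) : ℝ := ∑ i, w i * a i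

/-- An element of `Ω`: a translation-invariant total order on `ℤ^n`. -/
structure TransOrder (n : ℕ) where
  le : (Fin n → ℤ) → (Fin n → ℤ) → Prop
  le_refl : ∀ a, le a a
  le_trans : ∀ a b c, le a b → le b c → le a c
  le_antisymm : ∀ a b, le a b → le b a → a = b
  le_total : ∀ a b, le a b ∨ le b a
  add_right : ∀ a b c, le a b → le (a + c) (b + c)

def TransOrder.lt {n : ℕ} (o : TransOrder n) (a b : Fin n → ℤ) : Prop :=
  o.le a b ∧ a ≠ b

/-- A finite set inside a subsemigroup of `ℤ^n` avoiding `0` is positive for some weight vector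
with `ℚ`-linearly independent coordinates (Fourier–Motzkin elimination of one coordinate). -/
theorem exists_linearIndependent_weight_pos {n : ℕ} (P : AddSubsemigroup (Fin n → ℤ))
    (hP : (0 : Fin n → ℤ) ∉ P) (S : Finset (Fin n → ℤ)) (hS : ∀ a ∈ S, a ∈ P) :
    ∃ w : Fin n → ℝ, LinearIndependent ℚ w ∧ ∀ a ∈ S, 0 < ∑ i, w i * (a i : ℝ) := by
  classical
  induction n with
  | zero =>
    refine ⟨0, linearIndependent_empty_type, fun a ha => (hP ?_).elim⟩
    simpa [Subsingleton.elim a 0] using hS a ha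
  | succ n ih =>
    have cons_tail {x : Fin (n + 1) → ℤ} (hx : x 0 = 0) :
        Fin.cons (α := fun _ => ℤ) 0 (Fin.tail x) = x := by
      rw [← hx, Fin.cons_self_tail]
    have zsmul_mem {k : ℤ} (hk : 0 < k) {x : Fin (n + 1) → ℤ} (hx : x ∈ P) : k • x ∈ P := by
      lift k to ℕ using hk.le
      rw [natCast_zsmul]
      have hk' : 1 ≤ k := by omega
      clear hk
      induction k, hk' using Nat.le_induction with
      | base => simpa using hx
      | succ m _ h => rw [succ_nsmul]; exact P.add_mem h hx
    let Q : AddSubsemigroup (Fin n → ℤ) :=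
      { carrier := {x | (Fin.cons (α := fun _ => ℤ) 0 x : Fin (n + 1) → ℤ) ∈ P}
        add_mem' := fun {x y} hx hy => by
          have h := P.add_mem hx hy
          have e : (Fin.cons (α := fun _ => ℤ) 0 x : Fin (n + 1) → ℤ) +
              Fin.cons (α := fun _ => ℤ) 0 y = Fin.cons (α := fun _ => ℤ) 0 (x + y) := by
            ext i; refine Fin.cases ?_ (fun j => ?_) i <;> simp
          rw [e] at h
          exact h }
    have hQ : (0 : Fin n → ℤ) ∉ Q := fun h => hP <| by
      have e : (Fin.cons (α := fun _ => ℤ) 0 (0 : Fin n → ℤ) : Fin (n + 1) → ℤ) = 0 := by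
        ext i; refine Fin.cases ?_ (fun j => ?_) i <;> simp
      exact e ▸ (show Fin.cons (α := fun _ => ℤ) 0 (0 : Fin n → ℤ) ∈ P from h)
    let T : Finset (Fin (n + 1) → ℤ) := {a ∈ S | a 0 = 0} ∪
      Finset.image₂ (fun a c => a 0 • c + (-c 0) • a) {a ∈ S | 0 < a 0} {c ∈ S | c 0 < 0}
    have hT : ∀ x ∈ T, x 0 = 0 ∧ x ∈ P := by
      intro x hx
      rcases Finset.mem_union.1 hx with hx | hx
      · rw [Finset.mem_filter] at hx
        exact ⟨hx.2, hS x hx.1⟩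
      · obtain ⟨a, ha, c, hc, rfl⟩ := Finset.mem_image₂.1 hx
        rw [Finset.mem_filter] at ha hc
        refine ⟨?_, P.add_mem (zsmul_mem ha.2 (hS c hc.1))
          (zsmul_mem (neg_pos.2 hc.2) (hS a ha.1))⟩
        simp only [Pi.add_apply, Pi.smul_apply, smul_eq_mul]
        ring
    obtain ⟨w, hw, hpos⟩ := ih Q hQ (T.image Fin.tail) fun y hy => by
      obtain ⟨x, hx, rfl⟩ := Finset.mem_image.1 hy
      show Fin.cons (α := fun _ => ℤ) 0 (Fin.tail x) ∈ P
      rw [cons_tail (hT x hx).1]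
      exact (hT x hx).2
    let d : (Fin (n + 1) → ℤ) → ℝ := fun a => ∑ i, w i * (a i.succ : ℝ)
    have hd : ∀ x ∈ T, 0 < d x := fun x hx => hpos _ (Finset.mem_image_of_mem _ hx)
    let L : Finset ℝ := {a ∈ S | 0 < a 0}.image fun a => -d a / a 0
    let U : Finset ℝ := {c ∈ S | c 0 < 0}.image fun c => -d c / c 0
    have hLU : ∀ l ∈ L, ∀ u ∈ U, l < u := by
      intro l hl u hu
      obtain ⟨a, ha, rfl⟩ := Finset.mem_image.1 hl
      obtain ⟨c, hc, rfl⟩ := Finset.mem_image.1 hu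
      have h := hd _ (Finset.mem_union_right _ (Finset.mem_image₂_of_mem ha hc))
      have e : d (a 0 • c + (-c 0) • a) = a 0 * d c + (-c 0) * d a := by
        simp only [d, Finset.mul_sum, ← Finset.sum_add_distrib]
        refine Finset.sum_congr rfl fun i _ => ?_
        simp only [Pi.add_apply, Pi.smul_apply, smul_eq_mul]
        push_cast
        ring
      rw [e] at h
      have ha0 : (0 : ℝ) < a 0 := by exact_mod_cast (Finset.mem_filter.1 ha).2
      have hc0 : (0 : ℝ) < -c 0 := by
        have := (Finset.mem_filter.1 hc).2
        exact_mod_cast neg_pos.2 this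
      rw [← neg_div_neg_eq (-d c), neg_neg, div_lt_div_iff₀ ha0 hc0]
      linarith
    obtain ⟨p, hLp, hpU⟩ := Order.exists_between_finsets L U hLU
    obtain ⟨q, hpq, hqU⟩ := Order.exists_between_finsets {p} U (by simpa using hpU)
    have hcount : (Submodule.span ℚ (Set.range w) : Set ℝ).Countable :=
      Set.countable_coe_iff.1 (inferInstanceAs (Countable (Submodule.span ℚ (Set.range w))))
    obtain ⟨x, hx, hpx, hxq⟩ := (hcount.dense_compl ℝ).exists_between (hpq p (by simp))
    refine ⟨Fin.cons x w, linearIndependent_finCons.2 ⟨hw, hx⟩, fun a ha => ?_⟩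
    have e : ∑ i, (Fin.cons x w : Fin (n + 1) → ℝ) i * (a i : ℝ) = x * a 0 + d a := by
      simp [Fin.sum_univ_succ, d]
    rw [e]
    rcases lt_trichotomy (a 0) 0 with h | h | h
    · have h' := hxq.trans (hqU _ (Finset.mem_image_of_mem _ (Finset.mem_filter.2 ⟨ha, h⟩)))
      rw [lt_div_iff_of_neg (by exact_mod_cast h)] at h'
      linarith
    · have h' := hd a (Finset.mem_union_left _ (Finset.mem_filter.2 ⟨ha, h⟩))
      simpa [h] using h'
    · have h' := (hLp _ (Finset.mem_image_of_mem _ (Finset.mem_filter.2 ⟨ha, h⟩))).trans hpx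
      rw [div_lt_iff₀ (by exact_mod_cast h)] at h'
      linarith

/-- Lemma 3.2: for `⪯ ∈ Ω` and `a_1, …, a_s ∈ ℤ^n` (`s ≥ 1`) with `a_i ≻ 0` for all `i`, there
is `w ∈ 𝒲` (i.e. `w ∈ ℝ^n` with coordinates linearly independent over `ℚ`) such that
`w·a_i > 0` for all `i`. -/
theorem stmt_11 {n : ℕ} (o : TransOrder n) {s : ℕ} (hs : 1 ≤ s)
    (a : Fin s → Fin n → ℤ) (ha : ∀ i, o.lt 0 (a i)) :
    ∃ w : Fin n → ℝ, LinearIndependent ℚ w ∧ ∀ i, 0 < dotR w (toR (a i)) := by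
  let P : AddSubsemigroup (Fin n → ℤ) :=
    { carrier := {x | o.lt 0 x}
      add_mem' := fun {x y} hx hy => by
        have h : o.le y (x + y) := by simpa using o.add_right 0 x y hx.1
        refine ⟨o.le_trans _ _ _ hy.1 h, fun h0 => hy.2 (o.le_antisymm _ _ hy.1 ?_)⟩
        rwa [← h0] at h }
  obtain ⟨w, hw, hpos⟩ := exists_linearIndependent_weight_pos P (fun h => h.2 rfl)
    (Finset.univ.image a) (by simpa using fun i => show a i ∈ P from ha i)
  exact ⟨w, hw, fun i => hpos (a i) (by simp)⟩
end

section
/- For every finite subset ℱ of ℤ^n and every ⪯ ∈ Ω, the set 𝒲_{ℱ,⪯} := {w ∈ 𝒲 : for all a,b ∈ ℱ, w·a < w·b if and only if a ≺ b} is nonempty. -/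
theorem dotR_sub {n : ℕ} (w : Fin n → ℝ) (a b : Fin n → ℤ) :
    dotR w (toR (b - a)) = dotR w (toR b) - dotR w (toR a) := by
  simp [dotR, toR, mul_sub]

theorem dotR_cons {n : ℕ} (x : ℝ) (w : Fin n → ℝ) (d : Fin (n + 1) → ℤ) :
    dotR (Fin.cons x w) (toR d) = x * d 0 + dotR w (toR (Fin.tail d)) := by
  simp [dotR, toR, Fin.sum_univ_succ, Fin.tail]

theorem dotR_add_smul {n : ℕ} (w : Fin n → ℝ) (a b : Fin n → ℤ) (k l : ℕ) :
    dotR w (toR (k • a + l • b)) = k * dotR w (toR a) + l * dotR w (toR b) := by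
  simp [dotR, toR, mul_add, Finset.sum_add_distrib, Finset.mul_sum, mul_left_comm]

theorem nsmul_mem_of_add_mem {M : Type*} [AddMonoid M] {P : Set M}
    (hadd : ∀ a ∈ P, ∀ b ∈ P, a + b ∈ P) {a : M} (ha : a ∈ P) {k : ℕ} (hk : 0 < k) :
    k • a ∈ P := by
  induction k, hk using Nat.le_induction with
  | base => simpa using ha
  | succ k _ ih => rw [succ_nsmul]; exact hadd _ ih _ ha

theorem countable_span_range {n : ℕ} (w : Fin n → ℝ) :
    (Submodule.span ℚ (Set.range w) : Set ℝ).Countable := by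
  refine (Set.countable_range fun q : Fin n → ℚ => ∑ i, q i • w i).mono fun x hx => ?_
  exact (Submodule.mem_span_range_iff_exists_fun ℚ).1 hx

/-- Gordan's alternative for a subset of `ℤ^n` closed under addition and avoiding `0`, proved by
Fourier–Motzkin elimination; the separating vector has `ℚ`-independent coordinates. -/
theorem exists_linearIndependent_dotR_pos {n : ℕ} (P : Set (Fin n → ℤ)) (h0 : 0 ∉ P)
    (hadd : ∀ a ∈ P, ∀ b ∈ P, a + b ∈ P) (D : Finset (Fin n → ℤ)) (hD : ∀ d ∈ D, d ∈ P) :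
    ∃ w : Fin n → ℝ, LinearIndependent ℚ w ∧ ∀ d ∈ D, 0 < dotR w (toR d) := by
  classical
  induction n with
  | zero =>
    refine ⟨0, linearIndependent_empty_type, fun d hd => ?_⟩
    exact absurd (Subsingleton.elim d 0 ▸ hD d hd) h0
  | succ n ih =>
    let Z := D.filter fun d => d 0 = 0
    let U := D.filter fun d => 0 < d 0
    let L := D.filter fun d => d 0 < 0
    let mix : (Fin (n + 1) → ℤ) × (Fin (n + 1) → ℤ) → (Fin (n + 1) → ℤ) := fun p =>
      (p.1 0).natAbs • p.2 + (p.2 0).natAbs • p.1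
    have hcons : ∀ d : Fin (n + 1) → ℤ, d 0 = 0 → Fin.cons 0 (Fin.tail d) = d := fun d h => by
      rw [← h, Fin.cons_self_tail]
    obtain ⟨w, hw, hpos⟩ := ih {x | (Fin.cons 0 x : Fin (n + 1) → ℤ) ∈ P}
      (by
        intro h
        refine h0 ?_
        convert (show (Fin.cons 0 0 : Fin (n + 1) → ℤ) ∈ P from h) using 1
        exact (Fin.cons_self_tail (0 : Fin (n + 1) → ℤ)).symm)
      (by
        intro a ha b hb
        have h := hadd _ ha _ hb
        rw [Set.mem_ofPred_eq]
        convert h using 1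
        ext i
        refine Fin.cases ?_ (fun j => ?_) i <;> simp)
      (Z.image Fin.tail ∪ (U ×ˢ L).image fun p => Fin.tail (mix p))
      (by
        intro x hx
        rw [Set.mem_ofPred_eq]
        rcases Finset.mem_union.1 hx with hx | hx
        · obtain ⟨d, hd, rfl⟩ := Finset.mem_image.1 hx
          obtain ⟨hd, hd0⟩ := Finset.mem_filter.1 hd
          rw [hcons d hd0]
          exact hD d hd
        · obtain ⟨⟨p, m⟩, hpm, rfl⟩ := Finset.mem_image.1 hx
          obtain ⟨hp, hm⟩ := Finset.mem_product.1 hpm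
          obtain ⟨hp, hp0⟩ := Finset.mem_filter.1 hp
          obtain ⟨hm, hm0⟩ := Finset.mem_filter.1 hm
          dsimp only at hp hp0 hm hm0 ⊢
          rw [hcons]
          · exact hadd _ (nsmul_mem_of_add_mem hadd (hD m hm) (Int.natAbs_pos.2 hp0.ne')) _
              (nsmul_mem_of_add_mem hadd (hD p hp) (Int.natAbs_pos.2 hm0.ne))
          · change (p 0).natAbs • m 0 + (m 0).natAbs • p 0 = 0
            rw [nsmul_eq_mul, nsmul_eq_mul, Int.natCast_natAbs, Int.natCast_natAbs,
              abs_of_pos hp0, abs_of_neg hm0]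
            ring)
    let lo := U.image fun d => -dotR w (toR (Fin.tail d)) / d 0
    let hi := L.image fun d => -dotR w (toR (Fin.tail d)) / d 0
    have hlohi : ∀ x ∈ lo, ∀ y ∈ hi, x < y := by
      intro x hx y hy
      obtain ⟨p, hp, rfl⟩ := Finset.mem_image.1 hx
      obtain ⟨m, hm, rfl⟩ := Finset.mem_image.1 hy
      have h := hpos _ (Finset.mem_union_right _
        (Finset.mem_image_of_mem _ (Finset.mk_mem_product hp hm)))
      have hp0 : 0 < p 0 := (Finset.mem_filter.1 hp).2
      have hm0 : m 0 < 0 := (Finset.mem_filter.1 hm).2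
      change 0 < dotR w (toR ((p 0).natAbs • Fin.tail m + (m 0).natAbs • Fin.tail p)) at h
      rw [dotR_add_smul, Nat.cast_natAbs, Nat.cast_natAbs, abs_of_pos hp0, abs_of_neg hm0] at h
      push_cast at h
      have hp1 : (0 : ℝ) < p 0 := by exact_mod_cast hp0
      have hm1 : (0 : ℝ) < -m 0 := by exact_mod_cast neg_pos.2 hm0
      rw [← neg_div_neg_eq (-dotR w (toR (Fin.tail m))), div_lt_div_iff₀ hp1 hm1]
      linarith
    obtain ⟨s, hslo, hshi⟩ := Order.exists_between_finsets lo hi hlohi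
    obtain ⟨t, htlo, hthi⟩ := Order.exists_between_finsets (insert s lo) hi (by
      intro x hx y hy
      rcases Finset.mem_insert.1 hx with rfl | hx
      · exact hshi y hy
      · exact hlohi x hx y hy)
    obtain ⟨x, hx, hsx, hxt⟩ := ((countable_span_range w).dense_compl ℝ).exists_between
      (htlo s (Finset.mem_insert_self _ _))
    refine ⟨Fin.cons x w, linearIndependent_finCons.2 ⟨hw, hx⟩, fun d hd => ?_⟩
    rw [dotR_cons]
    rcases lt_trichotomy (d 0) 0 with h | h | h
    · have h1 := hxt.trans (hthi _ (Finset.mem_image_of_mem _ (Finset.mem_filter.2 ⟨hd, h⟩)))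
      rw [lt_div_iff_of_neg (by exact_mod_cast h)] at h1
      linarith
    · have h1 := hpos _ (Finset.mem_union_left _
        (Finset.mem_image_of_mem _ (Finset.mem_filter.2 ⟨hd, h⟩)))
      simpa [h] using h1
    · have h1 := (hslo _ (Finset.mem_image_of_mem _ (Finset.mem_filter.2 ⟨hd, h⟩))).trans hsx
      rw [div_lt_iff₀ (by exact_mod_cast h)] at h1
      linarith

theorem TransOrder.lt_iff_lt_sub {n : ℕ} (o : TransOrder n) (a b : Fin n → ℤ) :
    o.lt a b ↔ o.lt 0 (b - a) := by
  constructor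
  · rintro ⟨h, hne⟩
    refine ⟨by simpa [sub_eq_add_neg] using o.add_right _ _ (-a) h, fun h => hne ?_⟩
    exact (sub_eq_zero.1 h.symm).symm
  · rintro ⟨h, hne⟩
    refine ⟨by simpa using o.add_right _ _ a h, fun h => hne ?_⟩
    simp [h]

theorem TransOrder.lt_zero_add {n : ℕ} (o : TransOrder n) {a b : Fin n → ℤ}
    (ha : o.lt 0 a) (hb : o.lt 0 b) : o.lt 0 (a + b) := by
  have h : o.le b (a + b) := by simpa using o.add_right _ _ b ha.1
  refine ⟨o.le_trans _ _ _ hb.1 h, fun h0 => hb.2 ?_⟩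
  exact o.le_antisymm _ _ hb.1 (h0 ▸ h)

/-- Lemma 3.3: for every finite `ℱ ⊆ ℤ^n` and every `⪯ ∈ Ω`, the set
`𝒲_{ℱ,⪯} = {w ∈ 𝒲 : (w·a < w·b ⟺ a ≺ b) for a, b ∈ ℱ}` is nonempty. -/
theorem stmt_12 {n : ℕ} (F : Finset (Fin n → ℤ)) (o : TransOrder n) :
    ∃ w : Fin n → ℝ, LinearIndependent ℚ w ∧
      ∀ a ∈ F, ∀ b ∈ F, (dotR w (toR a) < dotR w (toR b) ↔ o.lt a b) := by
  classical
  obtain ⟨w, hw, hpos⟩ := exists_linearIndependent_dotR_pos {d | o.lt 0 d}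
    (fun h => h.2 rfl) (fun a ha b hb => o.lt_zero_add ha hb)
    (((F ×ˢ F).image fun p => p.2 - p.1).filter fun d => o.lt 0 d)
    (fun d hd => (Finset.mem_filter.1 hd).2)
  have key : ∀ a ∈ F, ∀ b ∈ F, o.lt a b → dotR w (toR a) < dotR w (toR b) := by
    intro a ha b hb hab
    rw [← sub_pos, ← dotR_sub]
    exact hpos _ (Finset.mem_filter.2 ⟨Finset.mem_image.2
      ⟨(a, b), Finset.mk_mem_product ha hb, rfl⟩, (o.lt_iff_lt_sub a b).1 hab⟩)
  refine ⟨w, hw, fun a ha b hb => ⟨fun h => ?_, key a ha b hb⟩⟩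
  have hne : a ≠ b := by rintro rfl; exact lt_irrefl _ h
  rcases o.le_total a b with hab | hba
  · exact ⟨hab, hne⟩
  · exact absurd (key b hb a ha ⟨hba, hne.symm⟩) h.not_gt
end

section
/- For every finite subset ℱ of ℤ^n and every ⪯ ∈ Ω, there exists w ∈ ℚ^n such that for all a, b ∈ ℱ: w·a < w·b if and only if a ≺ b. -/
/-- The standard inner product with rational weight vector: `w·a` for `w ∈ ℚ^n`, `a ∈ ℤ^n`. -/
def dotQ {n : ℕ} (w : Fin n → ℚ) (a : Fin n → ℤ) : ℚ := ∑ i, w i * (a i : ℚ)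

theorem dotQ_sub {n : ℕ} (w : Fin n → ℚ) (a b : Fin n → ℤ) :
    dotQ w (a - b) = dotQ w a - dotQ w b := by
  simp [dotQ, mul_sub]

theorem dotQ_add {n : ℕ} (w : Fin n → ℚ) (a b : Fin n → ℤ) :
    dotQ w (a + b) = dotQ w a + dotQ w b := by
  simp [dotQ, mul_add, Finset.sum_add_distrib]

theorem dotQ_smul {n : ℕ} (w : Fin n → ℚ) (k : ℤ) (a : Fin n → ℤ) :
    dotQ w (k • a) = k * dotQ w a := by
  simp [dotQ, Finset.mul_sum, mul_left_comm]

theorem dotQ_cons {n : ℕ} (c : ℚ) (w : Fin n → ℚ) (a : Fin (n + 1) → ℤ) :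
    dotQ (Fin.cons c w : Fin (n + 1) → ℚ) a = c * a 0 + dotQ w (Fin.tail a) := by
  simp [dotQ, Fin.sum_univ_succ, Fin.tail]

/-- A finite subset of a convex cone of `ℤ^n` without `0` lies in an open rational half-space.
The proof is Fourier–Motzkin elimination. -/
theorem exists_dotQ_pos {n : ℕ} (P : Set (Fin n → ℤ)) (h_zero : 0 ∉ P)
    (h_add : ∀ x ∈ P, ∀ y ∈ P, x + y ∈ P) (h_smul : ∀ k : ℤ, 0 < k → ∀ x ∈ P, k • x ∈ P)
    (S : Finset (Fin n → ℤ)) (hS : ∀ s ∈ S, s ∈ P) :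
    ∃ w : Fin n → ℚ, ∀ s ∈ S, 0 < dotQ w s := by
  classical
  induction n with
  | zero =>
    refine ⟨0, fun s hs => absurd (hS s hs) ?_⟩
    rwa [Subsingleton.elim s 0]
  | succ n ih =>
    have cons_tail (x : Fin (n + 1) → ℤ) (hx : x 0 = 0) :
        (Fin.cons 0 (Fin.tail x) : Fin (n + 1) → ℤ) = x := by
      rw [← hx, Fin.cons_self_tail]
    set comb : (Fin (n + 1) → ℤ) × (Fin (n + 1) → ℤ) → Fin (n + 1) → ℤ :=
      fun p => (-(p.2 0)) • p.1 + (p.1 0) • p.2 with hcomb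
    set Sz := S.filter (fun s => s 0 = 0)
    set Sp := S.filter (fun s => 0 < s 0)
    set Sn := S.filter (fun s => s 0 < 0)
    obtain ⟨w, hw⟩ := ih {x | (Fin.cons 0 x : Fin (n + 1) → ℤ) ∈ P}
      (by
        have h : (Fin.cons 0 0 : Fin (n + 1) → ℤ) = 0 := cons_tail 0 rfl
        rwa [Set.mem_ofPred_eq, h])
      (fun x hx y hy => by
        rw [Set.mem_ofPred_eq]
        convert h_add _ hx _ hy using 1
        ext i; refine Fin.cases ?_ (fun j => ?_) i <;> simp)
      (fun k hk x hx => by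
        rw [Set.mem_ofPred_eq]
        convert h_smul k hk _ hx using 1
        ext i; refine Fin.cases ?_ (fun j => ?_) i <;> simp)
      (Sz.image Fin.tail ∪ (Sp ×ˢ Sn).image (fun p => Fin.tail (comb p)))
      (by
        intro s hs
        rcases Finset.mem_union.1 hs with hs | hs
        · obtain ⟨x, hx, rfl⟩ := Finset.mem_image.1 hs
          obtain ⟨hxS, hx0⟩ := Finset.mem_filter.1 hx
          simpa only [Set.mem_ofPred_eq, cons_tail x hx0] using hS x hxS
        · obtain ⟨⟨x, y⟩, hxy, rfl⟩ := Finset.mem_image.1 hs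
          obtain ⟨hx, hy⟩ := Finset.mem_product.1 hxy
          obtain ⟨hxS, hx0⟩ := Finset.mem_filter.1 hx
          obtain ⟨hyS, hy0⟩ := Finset.mem_filter.1 hy
          have h0 : comb (x, y) 0 = 0 := by simp [hcomb]; ring
          simp only [Set.mem_ofPred_eq, cons_tail _ h0]
          exact h_add _ (h_smul _ (neg_pos.2 hy0) _ (hS x hxS)) _ (h_smul _ hx0 _ (hS y hyS)))
    have hlohi : ∀ a ∈ Sp.image (fun s => -dotQ w (Fin.tail s) / s 0),
        ∀ b ∈ Sn.image (fun s => -dotQ w (Fin.tail s) / s 0), a < b := by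
      intro a ha b hb
      obtain ⟨x, hx, rfl⟩ := Finset.mem_image.1 ha
      obtain ⟨y, hy, rfl⟩ := Finset.mem_image.1 hb
      have hx0 : (0 : ℚ) < x 0 := by exact_mod_cast (Finset.mem_filter.1 hx).2
      have hy0 : (y 0 : ℚ) < 0 := by exact_mod_cast (Finset.mem_filter.1 hy).2
      have h := hw _ (Finset.mem_union_right _ (Finset.mem_image_of_mem _
        (Finset.mk_mem_product hx hy)))
      have htail : Fin.tail (comb (x, y)) = (-(y 0)) • Fin.tail x + (x 0) • Fin.tail y := rfl
      rw [htail, dotQ_add, dotQ_smul, dotQ_smul] at h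
      push_cast at h
      rw [div_lt_iff₀ hx0, div_mul_eq_mul_div, lt_div_iff_of_neg hy0]
      linarith
    obtain ⟨c, hlo, hhi⟩ := Order.exists_between_finsets _ _ hlohi
    refine ⟨Fin.cons c w, fun s hs => ?_⟩
    rw [dotQ_cons]
    rcases lt_trichotomy (s 0) 0 with h0 | h0 | h0
    · have h := hhi _ (Finset.mem_image_of_mem _ (Finset.mem_filter.2 ⟨hs, h0⟩))
      rw [lt_div_iff_of_neg (by exact_mod_cast h0)] at h
      linarith
    · have h := hw _ (Finset.mem_union_left _
        (Finset.mem_image_of_mem _ (Finset.mem_filter.2 ⟨hs, h0⟩)))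
      simpa [h0] using h
    · have h := hlo _ (Finset.mem_image_of_mem _ (Finset.mem_filter.2 ⟨hs, h0⟩))
      rw [div_lt_iff₀ (by exact_mod_cast h0)] at h
      linarith

namespace TransOrder

variable {n : ℕ} (o : TransOrder n)

theorem lt_iff_zero_lt_sub (a b : Fin n → ℤ) : o.lt a b ↔ o.lt 0 (b - a) := by
  refine and_congr ⟨fun h => ?_, fun h => ?_⟩ (not_congr ?_)
  · simpa [sub_eq_add_neg] using o.add_right _ _ (-a) h
  · simpa using o.add_right _ _ a h
  · rw [eq_comm, eq_comm (a := 0), sub_eq_zero]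

theorem zero_lt_add {x y : Fin n → ℤ} (hx : o.lt 0 x) (hy : o.lt 0 y) : o.lt 0 (x + y) := by
  have h : o.le y (x + y) := by simpa using o.add_right _ _ y hx.1
  refine ⟨o.le_trans _ _ _ hy.1 h, fun h0 => hy.2 (o.le_antisymm _ _ hy.1 ?_)⟩
  rwa [← h0] at h

theorem zero_lt_nsmul {x : Fin n → ℤ} (hx : o.lt 0 x) (k : ℕ) : o.lt 0 ((k + 1) • x) := by
  induction k with
  | zero => simpa using hx
  | succ k ih => rw [succ_nsmul]; exact o.zero_lt_add ih hx

theorem zero_lt_zsmul {x : Fin n → ℤ} (hx : o.lt 0 x) {k : ℤ} (hk : 0 < k) :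
    o.lt 0 (k • x) := by
  obtain ⟨m, rfl⟩ := Int.eq_succ_of_zero_lt hk
  rw [← Nat.cast_succ, natCast_zsmul]
  exact o.zero_lt_nsmul hx m

end TransOrder

/-- Remark after Lemma 3.3: for every finite `ℱ ⊆ ℤ^n` and every `⪯ ∈ Ω`, there exists
`w ∈ ℚ^n` such that `w·a < w·b ⟺ a ≺ b` for all `a, b ∈ ℱ`. -/
theorem stmt_13 {n : ℕ} (F : Finset (Fin n → ℤ)) (o : TransOrder n) :
    ∃ w : Fin n → ℚ, ∀ a ∈ F, ∀ b ∈ F, (dotQ w a < dotQ w b ↔ o.lt a b) := by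
  classical
  obtain ⟨w, hw⟩ := exists_dotQ_pos {x | o.lt 0 x} (fun h => h.2 rfl)
    (fun x hx y hy => o.zero_lt_add hx hy) (fun k hk x hx => o.zero_lt_zsmul hx hk)
    (((F ×ˢ F).image (fun p => p.2 - p.1)).filter (fun x => o.lt 0 x))
    (fun s hs => (Finset.mem_filter.1 hs).2)
  have key : ∀ a ∈ F, ∀ b ∈ F, o.lt a b → dotQ w a < dotQ w b := by
    intro a ha b hb hab
    have h := hw (b - a) (Finset.mem_filter.2 ⟨Finset.mem_image.2
      ⟨(a, b), Finset.mk_mem_product ha hb, rfl⟩, (o.lt_iff_zero_lt_sub a b).1 hab⟩)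
    rwa [dotQ_sub, sub_pos] at h
  refine ⟨w, fun a ha b hb => ⟨fun h => ?_, key a ha b hb⟩⟩
  have hne : a ≠ b := by rintro rfl; exact lt_irrefl _ h
  refine ⟨(o.le_total a b).resolve_right fun hba => ?_, hne⟩
  exact lt_asymm h (key b hb a ha ⟨hba, hne.symm⟩)
end
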